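/- Let β ∈ [0, 3/4) and 0 ≤ e < 1/(1 + √(f(β))), or β ∈ (3/4, 1) and 0 ≤ e < f(β)^{−1/2}. Then the monodromy matrix γ_{β,e}(2π) is spectrally stable, i.e., every complex eigenvalue of γ_{β,e}(2π) has modulus 1. -/

import Mathlib

open Real Matrix

attribute [local instance] Matrix.normedAddCommGroup

noncomputable section

/-- The standard symplectic matrix `J = [[0,-1],[1,0]]`. -/
def Jmat : Matrix (Fin 2) (Fin 2) ℝ := !![0, -1; 1, 0]

/-- The coefficient matrix `B_{β,e}(t) = diag(1, 1 - β/(1 + e cos t))`. -/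
def Bmat (β e t : ℝ) : Matrix (Fin 2) (Fin 2) ℝ :=
  !![1, 0; 0, 1 - β / (1 + e * Real.cos t)]

/-- `γ` is the fundamental solution of `γ' = J B_{β,e} γ`, `γ(0) = I₂`
(derivative taken entrywise). -/
def IsFundSol (β e : ℝ) (γ : ℝ → Matrix (Fin 2) (Fin 2) ℝ) : Prop :=
  γ 0 = 1 ∧ ∀ (t : ℝ) (i j : Fin 2),
    HasDerivAt (fun s => γ s i j) ((Jmat * Bmat β e t * γ t) i j) t

/-- The trace-formula function `f(β,-1)`. -/
def fTrace (β : ℝ) : ℝ :=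
  β ^ 2 / (2 * (1 - β)) *
    ∫ s in (π / 2)..(3 * π / 2), ∫ t in (π / 2)..(3 * π / 2),
      Real.cos s * Real.cos t *
        (Real.cos (2 * π * Real.sqrt (1 - β) * (s - t)) ^ 2 /
            Real.cos (π * Real.sqrt (1 - β)) ^ 2 -
          Real.cos (4 * π * Real.sqrt (1 - β) * (s - t + 1 / 4)) /
            Real.cos (π * Real.sqrt (1 - β)))

/-- `y` solves `y'' = -q y` with `y' = p`. -/
def Sol (q y p : ℝ → ℝ) : Prop :=
  ∀ t, HasDerivAt y (p t) t ∧ HasDerivAt p (-(q t * y t)) t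

lemma wronskian_const {q y p z r : ℝ → ℝ} (h1 : Sol q y p) (h2 : Sol q z r) (a b : ℝ) :
    y a * r a - p a * z a = y b * r b - p b * z b := by
  have hd : ∀ t, HasDerivAt (fun t => y t * r t - p t * z t) 0 t := by
    intro t
    exact (((h1 t).1.mul (h2 t).2).sub ((h1 t).2.mul (h2 t).1)).congr_deriv (by ring)
  exact is_const_of_deriv_eq_zero (fun t => (hd t).differentiableAt) (fun t => (hd t).deriv) a b

lemma first_zero {f : ℝ → ℝ} (hf : Continuous f) {a t1 : ℝ}
    (h0 : ∀ᶠ t in nhdsWithin a (Set.Ioi a), 0 < f t) (h1 : a < t1) (h2 : f t1 ≤ 0) :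
    ∃ t0, a < t0 ∧ t0 ≤ t1 ∧ f t0 = 0 ∧ ∀ t, a < t → t < t0 → 0 < f t := by
  obtain ⟨u, hu, hu2⟩ := (mem_nhdsGT_iff_exists_Ioo_subset).1 h0
  have hu' : a < u := hu
  have hut : u ≤ t1 := by
    by_contra h
    push Not at h
    have : 0 < f t1 := hu2 ⟨h1, h⟩
    linarith
  set S : Set ℝ := {t | u ≤ t ∧ t ≤ t1 ∧ f t ≤ 0} with hS
  have hSc : IsClosed S := by
    have : S = Set.Icc u t1 ∩ f ⁻¹' (Set.Iic 0) := by
      ext t; simp [hS, and_assoc]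
    rw [this]
    exact isClosed_Icc.inter (isClosed_Iic.preimage hf)
  have hSb : BddBelow S := ⟨u, fun t ht => ht.1⟩
  have hSn : S.Nonempty := ⟨t1, hut, le_refl _, h2⟩
  have hm := hSc.csInf_mem hSn hSb
  set t0 := sInf S
  have hpos : ∀ t, a < t → t < t0 → 0 < f t := by
    intro t hat htt
    by_contra hneg
    push Not at hneg
    rcases lt_or_ge t u with h | h
    · have : 0 < f t := hu2 ⟨hat, h⟩
      linarith
    · have : t0 ≤ t := csInf_le hSb ⟨h, by linarith [hm.2.1], hneg⟩
      linarith
  have hat0 : a < t0 := lt_of_lt_of_le hu' hm.1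
  refine ⟨t0, hat0, hm.2.1, le_antisymm hm.2.2 ?_, hpos⟩
  have h3 : Filter.Tendsto f (nhdsWithin t0 (Set.Iio t0)) (nhds (f t0)) :=
    hf.continuousAt.tendsto.mono_left nhdsWithin_le_nhds
  refine ge_of_tendsto h3 ?_
  filter_upwards [Ioo_mem_nhdsLT hat0] with t ht
  exact (hpos t ht.1 ht.2).le

lemma mono_of_deriv {f f' : ℝ → ℝ} {a b : ℝ} (hab : a ≤ b)
    (hc : ContinuousOn f (Set.Icc a b))
    (hd : ∀ t, a < t → t < b → HasDerivAt f (f' t) t) (hn : ∀ t, a < t → t < b → 0 ≤ f' t) :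
    f a ≤ f b := by
  have : MonotoneOn f (Set.Icc a b) := by
    apply monotoneOn_of_deriv_nonneg (convex_Icc a b) hc
    · intro t ht
      rw [interior_Icc] at ht
      exact (hd t ht.1 ht.2).differentiableAt.differentiableWithinAt
    · intro t ht
      rw [interior_Icc] at ht
      rw [(hd t ht.1 ht.2).deriv]
      exact hn t ht.1 ht.2
  exact this ⟨le_refl _, hab⟩ ⟨hab, le_refl _⟩ hab

lemma Sol.cont {q y p : ℝ → ℝ} (h : Sol q y p) : Continuous y :=
  continuous_iff_continuousAt.2 fun t => (h t).1.continuousAt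

lemma Sol.cont' {q y p : ℝ → ℝ} (h : Sol q y p) : Continuous p :=
  continuous_iff_continuousAt.2 fun t => (h t).2.continuousAt

lemma Sol.neg {q y p : ℝ → ℝ} (h : Sol q y p) : Sol q (fun t => - y t) (fun t => - p t) := by
  intro t
  exact ⟨(h t).1.neg, (h t).2.neg.congr_deriv (by ring)⟩

lemma wron_deriv {q y p v v' v'' : ℝ → ℝ} (h : Sol q y p)
    (hv : ∀ t, HasDerivAt v (v' t) t) (hv' : ∀ t, HasDerivAt v' (v'' t) t) (t : ℝ) :
    HasDerivAt (fun t => p t * v t - y t * v' t) (-(y t) * (v'' t + q t * v t)) t := by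
  exact (((h t).2.mul (hv t)).sub ((h t).1.mul (hv' t))).congr_deriv (by ring)

lemma sturm {q y p v v' v'' : ℝ → ℝ} (h : Sol q y p)
    (hv : ∀ t, HasDerivAt v (v' t) t) (hv' : ∀ t, HasDerivAt v' (v'' t) t) {a b : ℝ}
    (hpos : ∀ t, a < t → t < b → 0 < v t)
    (hq : ∀ t, a < t → t < b → v'' t + q t * v t ≤ 0)
    (h0 : ∀ᶠ t in nhdsWithin a (Set.Ioi a), 0 < y t)
    (hw : 0 ≤ p a * v a - y a * v' a) :
    ∀ t, a < t → t < b → 0 < y t := by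
  intro t1 hat1 ht1b
  by_contra hneg
  push Not at hneg
  obtain ⟨t0, hat0, ht01, hz, hyp⟩ := first_zero h.cont h0 hat1 hneg
  have hW : ∀ t, a < t → t < t0 → 0 ≤ p t * v t - y t * v' t := by
    intro t hat htt
    refine hw.trans (mono_of_deriv (f := fun t => p t * v t - y t * v' t) hat.le ?_
      (fun s _ _ => wron_deriv h hv hv' s) ?_)
    · exact fun s _ => (wron_deriv h hv hv' s).continuousAt.continuousWithinAt
    · intro s hs1 hs2
      have := hyp s hs1 (by linarith)
      have := hq s hs1 (by linarith)
      nlinarith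
  set m := (a + t0) / 2
  have hm1 : a < m := by simp only [m]; linarith
  have hm2 : m < t0 := by simp only [m]; linarith
  have hkey : y m / v m ≤ y t0 / v t0 := by
    have hvne : ∀ s, m ≤ s → s ≤ t0 → 0 < v s := fun s h1 h2 =>
      hpos s (by linarith) (by linarith)
    refine mono_of_deriv (f := fun t => y t / v t)
      (f' := fun t => (p t * v t - y t * v' t) / v t ^ 2) hm2.le ?_ ?_ ?_
    · intro s hs
      exact ((h s).1.div (hv s) (hvne s hs.1 hs.2).ne').continuousAt.continuousWithinAt
    · intro s h1 h2
      exact (h s).1.div (hv s) (hvne s h1.le h2.le).ne'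
    · intro s h1 h2
      exact div_nonneg (hW s (by linarith) h2) (sq_nonneg _)
  rw [hz, zero_div] at hkey
  have h1 := hyp m hm1 hm2
  have h2 := hpos m hm1 (by linarith)
  have := div_pos h1 h2
  linarith

lemma ev_pos_of_pos {f : ℝ → ℝ} (hf : Continuous f) {a : ℝ} (h : 0 < f a) :
    ∀ᶠ t in nhdsWithin a (Set.Ioi a), 0 < f t :=
  (hf.continuousAt.eventually (lt_mem_nhds h)).filter_mono nhdsWithin_le_nhds

lemma ev_pos_of_deriv {f : ℝ → ℝ} {f' a : ℝ} (hf : HasDerivAt f f' a) (h0 : f a = 0)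
    (h : 0 < f') : ∀ᶠ t in nhdsWithin a (Set.Ioi a), 0 < f t := by
  have h1 := hf.tendsto_slope
  have h2 : Filter.Tendsto (slope f a) (nhdsWithin a (Set.Ioi a)) (nhds f') :=
    h1.mono_left (nhdsWithin_mono _ (fun x hx => ne_of_gt hx))
  filter_upwards [h2.eventually (lt_mem_nhds h), self_mem_nhdsWithin] with t ht hta
  rw [slope_def_field, h0, sub_zero] at ht
  have : 0 < t - a := sub_pos.2 hta
  by_contra hn
  push Not at hn
  have := div_nonpos_of_nonpos_of_nonneg hn this.le
  linarith

lemma pos_half {q y p : ℝ → ℝ} (h : Sol q y p) (hq : ∀ t, q t ≤ 1) (h0 : y 0 = 1) (h1 : p 0 = 0) :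
    ∀ t, 0 < t → t < π / 2 → 0 < y t := by
  refine sturm (v := Real.cos) (v' := fun t => - Real.sin t) (v'' := fun t => - Real.cos t) h
    (fun t => Real.hasDerivAt_cos t) (fun t => (Real.hasDerivAt_sin t).neg) ?_ ?_ ?_ ?_
  · intro t h1 h2
    exact Real.cos_pos_of_mem_Ioo ⟨by linarith, h2⟩
  · intro t h1 h2
    have := Real.cos_pos_of_mem_Ioo ⟨by linarith, h2⟩
    nlinarith [hq t]
  · exact ev_pos_of_pos h.cont (by rw [h0]; norm_num)
  · simp [h1]

lemma dichotomy {q y p : ℝ → ℝ} (h : Sol q y p) (hq : ∀ t, q t ≤ 1) (h0 : y 0 = 1) (h1 : p 0 = 0)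
    (hnd : ∀ t, y t = 0 → p t ≠ 0) :
    (∀ t, 0 ≤ t → t ≤ π → 0 < y t) ∨ ∃ t0, π / 2 ≤ t0 ∧ t0 ≤ π ∧ y t0 = 0 ∧ p t0 < 0 ∧
      ∀ t, t0 < t → t ≤ π → y t < 0 := by
  by_cases hall : ∀ t, 0 ≤ t → t ≤ π → 0 < y t
  · exact Or.inl hall
  right
  push Not at hall
  obtain ⟨t1, ht1, ht1π, hy1⟩ := hall
  have ht1' : 0 < t1 := by
    rcases ht1.lt_or_eq with h' | h'
    · exact h'
    · rw [← h', h0] at hy1; linarith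
  have hev := ev_pos_of_pos h.cont (a := 0) (by rw [h0]; norm_num)
  obtain ⟨t0, hat0, ht01, hz, hyp⟩ := first_zero h.cont hev ht1' hy1
  have hp : p t0 < 0 := by
    refine lt_of_le_of_ne ?_ (hnd t0 hz)
    by_contra hp
    push Not at hp
    have hdn : HasDerivAt (fun s => y (-s)) (-(p t0)) (-t0) := by
      have h2 : HasDerivAt y (p t0) (-(-t0)) := by rw [neg_neg]; exact (h t0).1
      exact (h2.comp (-t0) (hasDerivAt_neg (-t0))).congr_deriv (by ring)
    have h3 := ev_pos_of_deriv (f := fun s => -y (-s)) (f' := p t0) (a := -t0)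
      (hdn.neg.congr_deriv (by ring)) (by simp [hz]) hp
    have h4 : ∀ᶠ s in nhdsWithin (-t0) (Set.Ioi (-t0)), s ∈ Set.Ioo (-t0) 0 :=
      Ioo_mem_nhdsGT (by linarith)
    obtain ⟨s, hs1, hs2⟩ := (h3.and h4).exists
    have := hyp (-s) (by linarith [hs2.2]) (by linarith [hs2.1])
    linarith
  refine ⟨t0, ?_, by linarith, hz, hp, ?_⟩
  · by_contra hlt
    push Not at hlt
    have := pos_half h hq h0 h1 t0 hat0 hlt
    linarith
  · intro t ht htπ
    have := sturm (v := fun t => Real.sin (t - t0)) (v' := fun t => Real.cos (t - t0))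
      (v'' := fun t => - Real.sin (t - t0)) (a := t0) (b := t0 + π) h.neg
      (fun t => by simpa using ((hasDerivAt_id t).sub_const t0).sin)
      (fun t => by simpa using ((hasDerivAt_id t).sub_const t0).cos)
      (fun t h1 h2 => Real.sin_pos_of_pos_of_lt_pi (by linarith) (by linarith))
      (fun t h1 h2 => by
        have := Real.sin_pos_of_pos_of_lt_pi (x := t - t0) (by linarith) (by linarith)
        nlinarith [hq t])
      (ev_pos_of_deriv (h.neg t0).1 (by simp [hz]) (by linarith))
      (by simp [hz]) t ht (by linarith)
    linarith

lemma s_nonneg {q y p : ℝ → ℝ} (h : Sol q y p) (hq : ∀ t, q t ≤ 1) (h0 : y 0 = 0) (h1 : p 0 = 1) :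
    0 ≤ y π := by
  have key : ∀ t, 0 < t → t < π → 0 < y t := by
    refine sturm (v := Real.sin) (v' := Real.cos) (v'' := fun t => - Real.sin t) h
      (fun t => Real.hasDerivAt_sin t) (fun t => Real.hasDerivAt_cos t) ?_ ?_ ?_ ?_
    · exact fun t h1 h2 => Real.sin_pos_of_pos_of_lt_pi h1 h2
    · intro t h1 h2
      have := Real.sin_pos_of_pos_of_lt_pi h1 h2
      nlinarith [hq t]
    · exact ev_pos_of_deriv (h 0).1 h0 (by rw [h1]; norm_num)
    · simp [h0]
  by_contra hneg
  push Not at hneg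
  have h3 : Filter.Tendsto y (nhdsWithin π (Set.Iio π)) (nhds (y π)) :=
    h.cont.continuousAt.tendsto.mono_left nhdsWithin_le_nhds
  have : 0 ≤ y π := by
    refine ge_of_tendsto h3 ?_
    filter_upwards [Ioo_mem_nhdsLT Real.pi_pos] with t ht
    exact (key t ht.1 ht.2).le
  linarith

/-- The Hill potential. -/
def qpot (β e t : ℝ) : ℝ := 1 - β / (1 + e * Real.cos t)

lemma den_pos {e : ℝ} (he : |e| < 1) (t : ℝ) : 0 < 1 + e * Real.cos t := by
  have h1 : |e * Real.cos t| ≤ |e| := by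
    rw [abs_mul]
    exact mul_le_of_le_one_right (abs_nonneg _) (Real.abs_cos_le_one t)
  have := neg_abs_le (e * Real.cos t)
  linarith

lemma qpot_le_one {β e : ℝ} (hβ : 0 ≤ β) (he : |e| < 1) (t : ℝ) : qpot β e t ≤ 1 := by
  have := div_nonneg hβ (den_pos he t).le
  unfold qpot; linarith

lemma cprime_nonpos {β e : ℝ} (hβ : 0 ≤ β) (hβ1 : β ≤ 1) (he : |e| < 1) {y p : ℝ → ℝ}
    (h : Sol (qpot β e) y p) (h0 : y 0 = 1) (h1 : p 0 = 0) (hnd : ∀ t, y t = 0 → p t ≠ 0) :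
    p π ≤ 0 := by
  rcases dichotomy h (qpot_le_one hβ he) h0 h1 hnd with hp | ⟨t0, ht1, ht2, hz, hpn, hneg⟩
  · have hv : ∀ t, HasDerivAt (fun t => 1 + e * Real.cos t) (-(e * Real.sin t)) t := fun t =>
      (((Real.hasDerivAt_cos t).const_mul e).const_add 1).congr_deriv (by ring)
    have hv' : ∀ t, HasDerivAt (fun t => -(e * Real.sin t)) (-(e * Real.cos t)) t := fun t =>
      ((Real.hasDerivAt_sin t).const_mul e).neg
    have := mono_of_deriv (a := 0) (b := π) Real.pi_pos.le
      (fun s _ => ((wron_deriv h hv hv' s).neg).continuousAt.continuousWithinAt)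
      (fun s _ _ => (wron_deriv h hv hv' s).neg) (by
        intro t ht1 ht2
        have hd := den_pos he t
        have hy := hp t ht1.le ht2.le
        have : -(e * Real.cos t) + qpot β e t * (1 + e * Real.cos t) = 1 - β := by
          unfold qpot; field_simp; ring
        rw [this]
        nlinarith)
    have hd := den_pos he π
    simp [h0, h1] at this
    simp at hd
    by_contra hc
    push Not at hc
    nlinarith
  · have hv : ∀ t, HasDerivAt Real.cos (-(Real.sin t)) t := fun t => Real.hasDerivAt_cos t
    have hv' : ∀ t, HasDerivAt (fun t => -(Real.sin t)) (-(Real.cos t)) t := fun t =>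
      (Real.hasDerivAt_sin t).neg
    have := mono_of_deriv (a := t0) (b := π) ht2
      (fun s _ => (wron_deriv h hv hv' s).continuousAt.continuousWithinAt)
      (fun s _ _ => wron_deriv h hv hv' s) (by
        intro t ht1' ht2'
        have hy := hneg t ht1' ht2'.le
        have hc := Real.cos_nonpos_of_pi_div_two_le_of_le (x := t) (by linarith) (by linarith)
        have hq := qpot_le_one hβ he t
        have : 0 ≤ -Real.cos t + qpot β e t * Real.cos t := by nlinarith
        nlinarith)
    have hc := Real.cos_nonpos_of_pi_div_two_le_of_le ht1 (by linarith)
    simp [hz] at this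
    nlinarith

lemma qpot_lower {β e : ℝ} (hβ : 0 ≤ β) (he : |e| < 1) (t : ℝ) :
    1 - β * (1 - e * Real.cos t + e ^ 2 / (1 - |e|) * Real.cos t ^ 2) ≤ qpot β e t := by
  have hd := den_pos he t
  have hle : 1 - |e| ≤ 1 + e * Real.cos t := by
    have h1 : |e * Real.cos t| ≤ |e| := by
      rw [abs_mul]
      exact mul_le_of_le_one_right (abs_nonneg _) (Real.abs_cos_le_one t)
    have := neg_abs_le (e * Real.cos t)
    linarith
  have h1 : 1 / (1 + e * Real.cos t) = 1 - e * Real.cos t +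
      (e * Real.cos t) ^ 2 / (1 + e * Real.cos t) := by field_simp; ring
  have h2 : (e * Real.cos t) ^ 2 / (1 + e * Real.cos t) ≤ (e * Real.cos t) ^ 2 / (1 - |e|) :=
    div_le_div_of_nonneg_left (sq_nonneg _) (by linarith) hle
  have h3 : (e * Real.cos t) ^ 2 / (1 - |e|) = e ^ 2 / (1 - |e|) * Real.cos t ^ 2 := by ring
  have h4 : β / (1 + e * Real.cos t) = β * (1 / (1 + e * Real.cos t)) := by ring
  unfold qpot
  rw [h4]
  have : 1 / (1 + e * Real.cos t) ≤ 1 - e * Real.cos t + e ^ 2 / (1 - |e|) * Real.cos t ^ 2 := by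
    linarith
  have := mul_le_mul_of_nonneg_left this hβ
  linarith

lemma qpot_upper {β e : ℝ} (hβ : 0 ≤ β) (he : |e| < 1) (t : ℝ) :
    qpot β e t ≤ 1 - β + β * e * Real.cos t := by
  have hd := den_pos he t
  have h1 : 1 / (1 + e * Real.cos t) = 1 - e * Real.cos t +
      (e * Real.cos t) ^ 2 / (1 + e * Real.cos t) := by field_simp; ring
  have h2 : 0 ≤ (e * Real.cos t) ^ 2 / (1 + e * Real.cos t) := div_nonneg (sq_nonneg _) hd.le
  have h4 : β / (1 + e * Real.cos t) = β * (1 / (1 + e * Real.cos t)) := by ring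
  unfold qpot
  rw [h4]
  have : 1 - e * Real.cos t ≤ 1 / (1 + e * Real.cos t) := by linarith
  have := mul_le_mul_of_nonneg_left this hβ
  linarith

lemma halfint_neg {β e : ℝ} (hβ : 0 ≤ β) (he : |e| < 1)
    (hcond : β * (1 + |e| / (2 * (1 - |e|))) < 3 / 4) {y p : ℝ → ℝ}
    (h : Sol (qpot β e) y p) (h0 : y 0 = 1) (h1 : p 0 = 0) (hnd : ∀ t, y t = 0 → p t ≠ 0) :
    y π ≤ 0 := by
  rcases dichotomy h (qpot_le_one hβ he) h0 h1 hnd with hp | ⟨t0, ht1, ht2, hz, hpn, hneg⟩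
  swap
  · rcases ht2.lt_or_eq with h' | h'
    · exact (hneg π h' le_rfl).le
    · rw [← h', hz]
  exfalso
  set K := e ^ 2 / (1 - |e|) with hK
  have hP : ∀ t, HasDerivAt (fun t => -(3 / 8) * t - 5 / 8 * Real.sin t + β / 2 * (t +
      (1 - e) * Real.sin t + (K - e) * ((t + Real.sin t * Real.cos t) / 2) +
      K * (Real.sin t - Real.sin t ^ 3 / 3)))
      (-(3 / 8) - 5 / 8 * Real.cos t + β / 2 * (1 +
      (1 - e) * Real.cos t + (K - e) * Real.cos t ^ 2 + K * Real.cos t ^ 3)) t := by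
    intro t
    have hs := Real.hasDerivAt_sin t
    have hc := Real.hasDerivAt_cos t
    have hi := hasDerivAt_id t
    refine (((hi.const_mul (-(3 / 8))).sub (hs.const_mul (5 / 8))).add
      ((((hi.add (hs.const_mul (1 - e))).add (((hi.add (hs.mul hc)).div_const 2).const_mul
      (K - e))).add ((hs.sub ((hs.pow 3).div_const 3)).const_mul K)).const_mul
      (β / 2))).congr_deriv ?_
    have := Real.sin_sq_add_cos_sq t
    have hsq : Real.sin t ^ 2 = 1 - Real.cos t ^ 2 := by linarith
    simp only [Nat.cast_ofNat, Nat.add_one_sub_one]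
    ring_nf
    rw [hsq]
    ring
  have hR : ∀ t, 0 ≤ t → t ≤ π → HasDerivAt (fun t => (1 + Real.cos t) / 2 * (p t / y t))
      (-(Real.sin t) / 2 * (p t / y t) + (1 + Real.cos t) / 2 *
        (-(qpot β e t) - (p t / y t) ^ 2)) t := by
    intro t ht1 ht2
    have hy := (hp t ht1 ht2).ne'
    refine ((((Real.hasDerivAt_cos t).const_add 1).div_const 2).mul
      ((h t).2.div (h t).1 hy)).congr_deriv ?_
    simp only [Pi.div_apply]
    field_simp
  have hD := fun t h1 h2 => (hP t).sub (hR t h1 h2)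
  have := mono_of_deriv (a := 0) (b := π) Real.pi_pos.le
      (fun s hs => (hD s hs.1 hs.2).continuousAt.continuousWithinAt)
      (fun s h1 h2 => hD s h1.le h2.le) (by
        intro t ht1 ht2
        set r := p t / y t
        have hq := qpot_lower hβ he t
        rw [← hK] at hq
        have hC : 0 ≤ 1 + Real.cos t := by linarith [Real.neg_one_le_cos t]
        have hsq := mul_le_mul_of_nonneg_left hq hC
        have hc2 : Real.cos t = 2 * Real.cos (t / 2) ^ 2 - 1 := by
          rw [← Real.cos_two_mul]; congr 1; ring
        have hs2 : Real.sin t = 2 * Real.sin (t / 2) * Real.cos (t / 2) := by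
          rw [← Real.sin_two_mul]; congr 1; ring
        have h5 : 0 ≤ (1 - Real.cos t) / 8 + Real.sin t / 2 * r + (1 + Real.cos t) / 2 * r ^ 2 := by
          have h6 : 1 = Real.sin (t / 2) ^ 2 + Real.cos (t / 2) ^ 2 :=
            (Real.sin_sq_add_cos_sq _).symm
          have : (1 - Real.cos t) / 8 + Real.sin t / 2 * r + (1 + Real.cos t) / 2 * r ^ 2
              = (Real.sin (t / 2) / 2 + Real.cos (t / 2) * r) ^ 2 := by
            rw [hc2, hs2]
            linear_combination (1 / 4 : ℝ) * h6
          rw [this]; positivity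
        nlinarith)
  simp [h0, h1] at this
  have he' : 0 < 1 - |e| := by linarith
  have hKe : K - e ≤ |e| / (1 - |e|) := by
    have : |e| / (1 - |e|) = K + |e| := by
      rw [hK]; field_simp; rw [← sq_abs]; ring
    rw [this]; linarith [neg_abs_le e]
  have h7 : |e| / (2 * (1 - |e|)) = (|e| / (1 - |e|)) / 2 := by field_simp
  rw [h7] at hcond
  have h8 := mul_le_mul_of_nonneg_left hKe hβ
  have h9 : -(3 / 8) + β / 2 * (1 + (K - e) / 2) < 0 := by nlinarith
  have := mul_neg_of_neg_of_pos h9 Real.pi_pos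
  nlinarith

lemma halfint_pos {β e : ℝ} (hβ : 3 / 4 ≤ β) (he : |e| < 1) (hx1 : |β * e| ≤ 1 / 2)
    (hcond : |β * e| / 2 + 3 / 4 * (β * e) ^ 2 ≤ β - 3 / 4) {y p : ℝ → ℝ}
    (h : Sol (qpot β e) y p) (h0 : y 0 = 1) (h1 : p 0 = 0) :
    0 ≤ y π := by
  set x := β * e with hx
  set a := x / 2 / (5 / 4 + β) with ha
  have hden : 0 < 5 / 4 + β := by linarith
  have hax : a * (5 / 4 + β) = x / 2 := by rw [ha]; field_simp
  have hxle := le_abs_self x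
  have hxge := neg_abs_le x
  have ha1 : |a| ≤ 1 / 8 := by
    rw [abs_le]; constructor <;> nlinarith
  have ha2 := abs_le.1 ha1
  have haxx : 0 ≤ a * x := by
    have : x = 2 * (a * (5 / 4 + β)) := by linarith
    rw [this]; nlinarith [mul_nonneg (sq_nonneg a) hden.le]
  have haxx2 : a * x ≤ x ^ 2 / 4 := by
    have : x ^ 2 / 2 = (a * x) * (5 / 4 + β) := by linear_combination (-x) * hax
    nlinarith
  have hc1 : ∀ t, HasDerivAt (fun t : ℝ => t / 2) (1 / 2) t := fun t =>
    (hasDerivAt_id t).div_const 2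
  have hc3 : ∀ t, HasDerivAt (fun t : ℝ => 3 * (t / 2)) (3 / 2) t := fun t =>
    ((hc1 t).const_mul 3).congr_deriv (by ring)
  have key : ∀ t, 0 < t → t < π → 0 < y t := by
    refine sturm (v := fun t => Real.cos (t / 2) + a * Real.cos (3 * (t / 2)))
      (v' := fun t => -(1 / 2) * Real.sin (t / 2) - 3 / 2 * a * Real.sin (3 * (t / 2)))
      (v'' := fun t => -(1 / 4) * Real.cos (t / 2) - 9 / 4 * a * Real.cos (3 * (t / 2))) h
      (fun t => ((hc1 t).cos.add ((hc3 t).cos.const_mul a)).congr_deriv (by ring))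
      (fun t => (((hc1 t).sin.const_mul (-(1 / 2))).sub
        ((hc3 t).sin.const_mul (3 / 2 * a))).congr_deriv (by ring)) ?_ ?_ ?_ ?_
    · intro t h1 h2
      have hc := Real.cos_pos_of_mem_Ioo (x := t / 2) ⟨by linarith, by linarith⟩
      have hcle := Real.cos_le_one (t / 2)
      rw [Real.cos_three_mul]
      set c := Real.cos (t / 2)
      have : c + a * (4 * c ^ 3 - 3 * c) = c * (1 + a * (4 * c ^ 2 - 3)) := by ring
      rw [this]
      apply mul_pos hc
      have hc2 : c ^ 2 ≤ 1 := by nlinarith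
      have hc20 : 0 ≤ c ^ 2 := sq_nonneg c
      nlinarith
    · intro t h1 h2
      have hc := Real.cos_pos_of_mem_Ioo (x := t / 2) ⟨by linarith, by linarith⟩
      have hcle := Real.cos_le_one (t / 2)
      have hq := qpot_upper (by linarith : (0:ℝ) ≤ β) he t
      have hct : Real.cos t = 2 * Real.cos (t / 2) ^ 2 - 1 := by
        rw [← Real.cos_two_mul]; congr 1; ring
      rw [← hx, hct] at hq
      rw [Real.cos_three_mul]
      set c := Real.cos (t / 2)
      have hc2 : c ^ 2 ≤ 1 := by nlinarith
      have hc20 : 0 ≤ c ^ 2 := sq_nonneg c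
      have hvpos : 0 ≤ c + a * (4 * c ^ 3 - 3 * c) := by
        have : c + a * (4 * c ^ 3 - 3 * c) = c * (1 + a * (4 * c ^ 2 - 3)) := by ring
        rw [this]
        apply mul_nonneg hc.le
        nlinarith
      have hm := mul_le_mul_of_nonneg_right hq hvpos
      have hid : -(1 / 4) * c - 9 / 4 * a * (4 * c ^ 3 - 3 * c) +
          (1 - β + x * (2 * c ^ 2 - 1)) * (c + a * (4 * c ^ 3 - 3 * c)) =
          c * (3 / 4 - β + x / 2 + a * x / 2 + a * x / 2 * (16 * c ^ 4 - 20 * c ^ 2 + 5)) := by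
        linear_combination (-(4 * c ^ 3 - 3 * c)) * hax
      have h4 : 16 * c ^ 4 - 20 * c ^ 2 + 5 ≤ 5 := by nlinarith
      have h5 := mul_le_mul_of_nonneg_left h4 haxx
      have h6 : c * (3 / 4 - β + x / 2 + a * x / 2 + a * x / 2 * (16 * c ^ 4 - 20 * c ^ 2 + 5)) ≤ 0 := by
        apply mul_nonpos_of_nonneg_of_nonpos hc.le
        nlinarith
      linarith
    · exact ev_pos_of_pos h.cont (by rw [h0]; norm_num)
    · simp [h1]
  have h3 : Filter.Tendsto y (nhdsWithin π (Set.Iio π)) (nhds (y π)) :=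
    h.cont.continuousAt.tendsto.mono_left nhdsWithin_le_nhds
  refine ge_of_tendsto h3 ?_
  filter_upwards [Ioo_mem_nhdsLT Real.pi_pos] with t ht
  exact (key t ht.1 ht.2).le

/-- Cosine moment of `cos` over the half period. -/
def Amom (k : ℝ) : ℝ := ∫ s in (π / 2)..(3 * π / 2), Real.cos s * Real.cos (k * (s - π))

lemma Bmom_zero (k : ℝ) :
    ∫ s in (π / 2)..(3 * π / 2), Real.cos s * Real.sin (k * (s - π)) = 0 := by
  have h := intervalIntegral.integral_comp_sub_left (a := π / 2) (b := 3 * π / 2)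
    (fun s => Real.cos s * Real.sin (k * (s - π))) (2 * π)
  have e1 : 2 * π - 3 * π / 2 = π / 2 := by ring
  have e2 : 2 * π - π / 2 = 3 * π / 2 := by ring
  rw [e1, e2] at h
  have h2 : (fun x => Real.cos (2 * π - x) * Real.sin (k * (2 * π - x - π))) =
      fun x => -(Real.cos x * Real.sin (k * (x - π))) := by
    funext x
    rw [Real.cos_two_pi_sub]
    have : k * (2 * π - x - π) = -(k * (x - π)) := by ring
    rw [this, Real.sin_neg]; ring
  rw [h2, intervalIntegral.integral_neg] at h
  linarith

lemma int_cos_half : ∫ s in (π / 2)..(3 * π / 2), Real.cos s = -2 := by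
  rw [integral_cos]
  have : 3 * π / 2 = π / 2 + π := by ring
  rw [this, Real.sin_add_pi, Real.sin_pi_div_two]; norm_num

lemma Amom_eq (k : ℝ) : (1 - k ^ 2) * Amom k = -2 * Real.cos (k * (π / 2)) := by
  unfold Amom
  rw [← intervalIntegral.integral_const_mul]
  have hd : ∀ s ∈ Set.uIcc (π / 2) (3 * π / 2), HasDerivAt
      (fun s => Real.sin s * Real.cos (k * (s - π)) - k * (Real.cos s * Real.sin (k * (s - π))))
      ((1 - k ^ 2) * (Real.cos s * Real.cos (k * (s - π)))) s := by
    intro s _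
    have hl : HasDerivAt (fun s : ℝ => k * (s - π)) k s :=
      (((hasDerivAt_id s).sub_const π).const_mul k).congr_deriv (by ring)
    exact (((Real.hasDerivAt_sin s).mul hl.cos).sub
      (((Real.hasDerivAt_cos s).mul hl.sin).const_mul k)).congr_deriv (by ring)
  rw [intervalIntegral.integral_eq_sub_of_hasDerivAt hd
    (Continuous.intervalIntegrable (by fun_prop) _ _)]
  have e0 : 3 * π / 2 = π / 2 + π := by ring
  have e1 : k * (π / 2 + π - π) = k * (π / 2) := by ring
  have e2 : k * (π / 2 - π) = -(k * (π / 2)) := by ring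
  rw [e0, e1, e2, Real.sin_add_pi, Real.cos_add_pi, Real.sin_pi_div_two, Real.cos_pi_div_two,
    Real.cos_neg]
  ring

lemma Amom_le_two (k : ℝ) : Amom k ^ 2 ≤ 4 := by
  have hpi := Real.pi_pos
  have h : |Amom k| ≤ 2 := by
    unfold Amom
    have h1 : ‖∫ s in (π / 2)..(3 * π / 2), Real.cos s * Real.cos (k * (s - π))‖ ≤
        ∫ s in (π / 2)..(3 * π / 2), -Real.cos s := by
      apply intervalIntegral.norm_integral_le_of_norm_le (by linarith)
      · refine Filter.Eventually.of_forall fun s hs => ?_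
        have hc := Real.cos_nonpos_of_pi_div_two_le_of_le hs.1.le (by linarith [hs.2])
        rw [Real.norm_eq_abs, abs_mul, abs_of_nonpos hc]
        exact mul_le_of_le_one_right (by linarith) (Real.abs_cos_le_one _)
      · exact Continuous.intervalIntegrable (by fun_prop) _ _
    rw [intervalIntegral.integral_neg, int_cos_half, Real.norm_eq_abs] at h1
    linarith
  have := abs_le.1 h
  nlinarith

lemma fTrace_eq (β : ℝ) (hc : Real.cos (π * Real.sqrt (1 - β)) ≠ 0) :
    fTrace β = β ^ 2 / (2 * (1 - β)) * (2 / Real.cos (π * Real.sqrt (1 - β)) ^ 2 +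
      (1 / (2 * Real.cos (π * Real.sqrt (1 - β)) ^ 2) - 1) *
        Amom (4 * π * Real.sqrt (1 - β)) ^ 2) := by
  unfold fTrace
  congr 1
  set w := Real.sqrt (1 - β)
  set c := Real.cos (π * w) with hcdef
  set T := Real.sin (π * w) / c with hT
  set k := 4 * π * w with hk
  set d := 1 / (2 * c ^ 2) with hd
  have hexpand : ∀ s t : ℝ, Real.cos s * Real.cos t *
        (Real.cos (2 * π * w * (s - t)) ^ 2 / c ^ 2 -
          Real.cos (k * (s - t + 1 / 4)) / c) =
      (d * Real.cos s) * Real.cos t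
      + ((d - 1) * Real.cos s * Real.cos (k * (s - π)) + T * Real.cos s * Real.sin (k * (s - π)))
          * (Real.cos t * Real.cos (k * (t - π)))
      + ((d - 1) * Real.cos s * Real.sin (k * (s - π)) - T * Real.cos s * Real.cos (k * (s - π)))
          * (Real.cos t * Real.sin (k * (t - π))) := by
    intro s t
    have e1 : Real.cos (2 * π * w * (s - t)) ^ 2 = (1 + Real.cos (k * (s - t))) / 2 := by
      rw [Real.cos_sq]
      have : 2 * (2 * π * w * (s - t)) = k * (s - t) := by rw [hk]; ring
      rw [this]; ring
    have e2 : Real.cos (k * (s - t + 1 / 4)) = Real.cos (k * (s - t)) * c -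
        Real.sin (k * (s - t)) * Real.sin (π * w) := by
      rw [hcdef, ← Real.cos_add]; congr 1; rw [hk]; ring
    have e3 : k * (s - t) = k * (s - π) - k * (t - π) := by ring
    rw [e1, e2, e3, Real.cos_sub, Real.sin_sub, hT, hd]
    field_simp
    ring
  have ic : IntervalIntegrable (fun t => Real.cos t) MeasureTheory.volume (π / 2) (3 * π / 2) :=
    Continuous.intervalIntegrable (by fun_prop) _ _
  have icc : IntervalIntegrable (fun t => Real.cos t * Real.cos (k * (t - π)))
    MeasureTheory.volume (π / 2) (3 * π / 2) := Continuous.intervalIntegrable (by fun_prop) _ _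
  have ics : IntervalIntegrable (fun t => Real.cos t * Real.sin (k * (t - π)))
    MeasureTheory.volume (π / 2) (3 * π / 2) := Continuous.intervalIntegrable (by fun_prop) _ _
  have hinner : ∀ s : ℝ, (∫ t in (π / 2)..(3 * π / 2), Real.cos s * Real.cos t *
        (Real.cos (2 * π * w * (s - t)) ^ 2 / c ^ 2 -
          Real.cos (k * (s - t + 1 / 4)) / c)) =
      (-2 * d) * Real.cos s + ((d - 1) * Amom k) * (Real.cos s * Real.cos (k * (s - π))) +
        (T * Amom k) * (Real.cos s * Real.sin (k * (s - π))) := by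
    intro s
    simp_rw [hexpand s]
    rw [intervalIntegral.integral_add ((ic.const_mul _).add (icc.const_mul _)) (ics.const_mul _),
      intervalIntegral.integral_add (ic.const_mul _) (icc.const_mul _),
      intervalIntegral.integral_const_mul, intervalIntegral.integral_const_mul,
      intervalIntegral.integral_const_mul, int_cos_half, Bmom_zero,
      show (∫ t in (π / 2)..(3 * π / 2), Real.cos t * Real.cos (k * (t - π))) = Amom k from rfl]
    ring
  simp_rw [hinner]
  rw [intervalIntegral.integral_add ((ic.const_mul _).add (icc.const_mul _)) (ics.const_mul _),
      intervalIntegral.integral_add (ic.const_mul _) (icc.const_mul _),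
      intervalIntegral.integral_const_mul, intervalIntegral.integral_const_mul,
      intervalIntegral.integral_const_mul, int_cos_half, Bmom_zero,
      show (∫ t in (π / 2)..(3 * π / 2), Real.cos t * Real.cos (k * (t - π))) = Amom k from rfl]
  have : 2 / c ^ 2 = 4 * d := by rw [hd]; field_simp; norm_num
  rw [this]
  ring

lemma num_low {w σ : ℝ} (hw : 1 / 2 < w) (h1 : σ ≤ 1) (h2 : σ ≤ 3.15 * (w - 1 / 2)) :
    w * σ ≤ 1.998 * (w ^ 2 - 1 / 4) := by
  have hw0 : 0 ≤ w := by linarith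
  norm_num at h2 ⊢
  rcases le_or_gt w (83 / 100) with h' | h'
  · have := mul_le_mul_of_nonneg_left h2 hw0
    have h3 : 0 ≤ (w - 1 / 2) * (83 / 100 - w) := mul_nonneg (by linarith) (by linarith)
    nlinarith
  · have := mul_le_mul_of_nonneg_left h1 hw0
    have h3 : 0 ≤ (w - 83 / 100) * (w - 83 / 100) := mul_self_nonneg _
    nlinarith

lemma num_high {w x : ℝ} (hw : 1 / 4 < w) (hw2 : w < 1 / 2) (hx : 0 ≤ x)
    (h : x ≤ w * (3.15 * (1 / 2 - w))) :
    x ≤ 1 / 2 ∧ x / 2 + 3 / 4 * x ^ 2 ≤ 1 / 4 - w ^ 2 := by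
  norm_num at h
  have hu : 0 < 1 / 2 - w := by linarith
  have h5 : w * (1 / 2 - w) ≤ 1 / 16 := by nlinarith [sq_nonneg (w - 1 / 4)]
  have hx5 : x ≤ 1 / 5 := by nlinarith
  refine ⟨by linarith, ?_⟩
  have h6 : x ^ 2 ≤ x * (w * (63 / 20 * (1 / 2 - w))) := by
    rw [pow_two]; exact mul_le_mul_of_nonneg_left h hx
  have h7 : x * (1 / 2 + 3 / 4 * (w * (63 / 20 * (1 / 2 - w)))) ≤
      (w * (63 / 20 * (1 / 2 - w))) * (1 / 2 + 3 / 4 * (w * (63 / 20 * (1 / 2 - w)))) := by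
    apply mul_le_mul_of_nonneg_right h
    have : 0 ≤ w * (63 / 20 * (1 / 2 - w)) := by
      apply mul_nonneg <;> linarith
    linarith
  have h8 : w * (63 / 20) * (1 / 2 + 3 / 4 * (w * (63 / 20 * (1 / 2 - w)))) ≤ 1 / 2 + w := by
    have h9 : w * (w * (1 / 2 - w)) ≤ w * (1 / 16) :=
      mul_le_mul_of_nonneg_left h5 (by linarith)
    nlinarith
  have h10 := mul_le_mul_of_nonneg_right h8 hu.le
  nlinarith

set_option maxHeartbeats 1000000 in
lemma cond_low {β e : ℝ} (hβ : 0 ≤ β) (hβ1 : β < 3 / 4) (he : 0 ≤ e) (he1 : e < 1)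
    (h : e < 1 / (1 + Real.sqrt (fTrace β))) : β * (1 + e / (2 * (1 - e))) < 3 / 4 := by
  rcases hβ.lt_or_eq with hβ0 | hβ0
  swap
  · rw [← hβ0]; norm_num
  rcases he.lt_or_eq with he0 | he0
  swap
  · rw [← he0]; simpa using hβ1
  set w := Real.sqrt (1 - β) with hw
  have hw2 : w ^ 2 = 1 - β := Real.sq_sqrt (by linarith)
  have hw0 : 0 ≤ w := Real.sqrt_nonneg _
  have hwh : 1 / 2 < w := by nlinarith
  have hw1 : w < 1 := by nlinarith
  have hpi := Real.pi_gt_three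
  have hpi2 := Real.pi_lt_d2
  set c := Real.cos (π * w) with hc
  have hceq : c = -Real.sin (π * w - π / 2) := by
    rw [Real.sin_sub_pi_div_two, neg_neg]
  have hs0 : 0 < Real.sin (π * w - π / 2) :=
    Real.sin_pos_of_pos_of_lt_pi (by nlinarith) (by nlinarith)
  have hsle : Real.sin (π * w - π / 2) ≤ π * w - π / 2 := Real.sin_le (by nlinarith)
  have hsle1 := Real.sin_le_one (π * w - π / 2)
  set σ := Real.sin (π * w - π / 2)
  have hc0 : c ≠ 0 := by rw [hceq]; linarith
  have hc2 : c ^ 2 = σ ^ 2 := by rw [hceq]; ring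
  have hf := fTrace_eq β hc0
  rw [← hw, ← hc, hc2, ← hw2] at hf
  set k := 4 * π * w with hk
  have hk6 : 6 < k := by rw [hk]; nlinarith
  have hA : Amom k ^ 2 ≤ 1 / 300 := by
    have h1 := Amom_eq k
    have h2 : ((1 - k ^ 2) * Amom k) ^ 2 ≤ 4 := by
      rw [h1]; nlinarith [Real.cos_sq_le_one (k * (π / 2))]
    rw [mul_pow] at h2
    have h30 : 36 ≤ k ^ 2 := by nlinarith
    have h3 : 1200 ≤ (1 - k ^ 2) ^ 2 := by nlinarith
    nlinarith [sq_nonneg (Amom k)]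
  set A := Amom k
  have hσ2 : 0 < σ ^ 2 := by positivity
  have hI : 1.998 / σ ^ 2 ≤ 2 / σ ^ 2 + (1 / (2 * σ ^ 2) - 1) * A ^ 2 := by
    have h1 : 2 / σ ^ 2 + (1 / (2 * σ ^ 2) - 1) * A ^ 2 - 1.998 / σ ^ 2
      = (0.002 + (1 / 2 - σ ^ 2) * A ^ 2) / σ ^ 2 := by field_simp; ring
    have h2 : 0 ≤ (0.002 + (1 / 2 - σ ^ 2) * A ^ 2) / σ ^ 2 := by
      apply div_nonneg _ hσ2.le
      have : σ ^ 2 ≤ 1 := by nlinarith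
      nlinarith [sq_nonneg A]
    linarith
  have hkey : w ^ 2 * σ ^ 2 ≤ 3.996 * (w ^ 2 - 1 / 4) ^ 2 := by
    have : w * σ ≤ 1.998 * (w ^ 2 - 1 / 4) := num_low hwh hsle1 (by
      refine hsle.trans ?_
      have := mul_le_mul_of_nonneg_right hpi2.le (by linarith : 0 ≤ w - 1 / 2)
      linarith)
    have h0 : 0 ≤ w * σ := by positivity
    have h1 := pow_le_pow_left₀ h0 this 2
    have h2 := sq_nonneg (w ^ 2 - 1 / 4)
    rw [mul_pow, mul_pow] at h1
    norm_num at h1 ⊢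
    linarith
  have hg : 0 < w ^ 2 - 1 / 4 := by nlinarith
  have hflow : (β / (2 * (w ^ 2 - 1 / 4))) ^ 2 ≤ fTrace β := by
    rw [hf]
    have h1 : β ^ 2 / (2 * w ^ 2) * (1.998 / σ ^ 2) ≤ β ^ 2 / (2 * w ^ 2) *
      (2 / σ ^ 2 + (1 / (2 * σ ^ 2) - 1) * A ^ 2) :=
      mul_le_mul_of_nonneg_left hI (by positivity)
    refine le_trans ?_ h1
    have h2 : β ^ 2 / (2 * w ^ 2) * (1.998 / σ ^ 2) = β ^ 2 * (0.999 / (w ^ 2 * σ ^ 2)) := by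
      field_simp; norm_num
    have h3 : (β / (2 * (w ^ 2 - 1 / 4))) ^ 2 = β ^ 2 * (1 / (4 * (w ^ 2 - 1 / 4) ^ 2)) := by
      rw [div_pow, mul_pow]; ring
    rw [h2, h3]
    apply mul_le_mul_of_nonneg_left _ (sq_nonneg _)
    rw [div_le_div_iff₀ (by positivity) (by positivity)]
    linarith
  have hsq : β / (2 * (w ^ 2 - 1 / 4)) ≤ Real.sqrt (fTrace β) := by
    apply Real.le_sqrt_of_sq_le hflow
  rw [div_le_iff₀ (by positivity)] at hsq
  have hS := Real.sqrt_nonneg (fTrace β)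
  set S := Real.sqrt (fTrace β)
  rw [lt_div_iff₀ (by linarith)] at h
  have h1e : 0 < 1 - e := by linarith
  have h5 : β * e < (2 * (w ^ 2 - 1 / 4)) * (1 - e) := by nlinarith
  have h6 : e / (2 * (1 - e)) * (2 * (1 - e)) = e := by field_simp
  have h7 : β * (e / (2 * (1 - e))) < w ^ 2 - 1 / 4 := by
    have : β * (e / (2 * (1 - e))) = β * e / (2 * (1 - e)) := by ring
    rw [this, div_lt_iff₀ (by linarith)]
    linarith
  linarith

set_option maxHeartbeats 1000000 in
lemma cond_high {β e : ℝ} (hβ : 3 / 4 < β) (hβ1 : β < 1) (he : 0 ≤ e)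
    (h : e < (fTrace β) ^ (-(1 : ℝ) / 2)) :
    β * e ≤ 1 / 2 ∧ (β * e) / 2 + 3 / 4 * (β * e) ^ 2 ≤ β - 3 / 4 := by
  set w := Real.sqrt (1 - β) with hw
  have hw2 : w ^ 2 = 1 - β := Real.sq_sqrt (by linarith)
  have hw0 : 0 < w := Real.sqrt_pos.2 (by linarith)
  have hwh : w < 1 / 2 := by nlinarith
  have hpi := Real.pi_gt_three
  have hpi2 := Real.pi_lt_d2
  set c := Real.cos (π * w) with hc
  have hcpos : 0 < c := Real.cos_pos_of_mem_Ioo ⟨by nlinarith, by nlinarith⟩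
  have hc1 : c ≤ 1 := Real.cos_le_one _
  have hf := fTrace_eq β hcpos.ne'
  rw [← hw, ← hc, ← hw2] at hf
  set A := Amom (4 * π * w)
  have hA : A ^ 2 ≤ 4 := Amom_le_two _
  set I := 2 / c ^ 2 + (1 / (2 * c ^ 2) - 1) * A ^ 2 with hI
  have hIc : I * c ^ 2 = 2 + (1 / 2 - c ^ 2) * A ^ 2 := by rw [hI]; field_simp
  -- I is nonnegative
  have hc2 : c ^ 2 ≤ 1 := by nlinarith
  have hIc0 : 0 ≤ I * c ^ 2 := by rw [hIc]; nlinarith [sq_nonneg A]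
  have hI0 : 0 ≤ I := nonneg_of_mul_nonneg_left hIc0 (by positivity)
  have hf0 : 0 ≤ fTrace β := by rw [hf]; positivity
  have hx2 : (β * e) ^ 2 * I ≤ 2 * w ^ 2 := by
    rcases hf0.lt_or_eq with hpos | hz
    swap
    · rw [← hz, Real.zero_rpow (by norm_num)] at h; linarith
    have h2 : e ^ 2 ≤ (fTrace β)⁻¹ := by
      have : ((fTrace β) ^ (-(1 : ℝ) / 2)) ^ 2 = (fTrace β)⁻¹ := by
        rw [← Real.rpow_natCast, ← Real.rpow_mul hf0]
        norm_num
        rw [Real.rpow_neg_one]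
      rw [← this]
      exact pow_le_pow_left₀ he h.le 2
    have h3 : e ^ 2 * fTrace β ≤ 1 := by
      calc e ^ 2 * fTrace β ≤ (fTrace β)⁻¹ * fTrace β := mul_le_mul_of_nonneg_right h2 hf0
        _ = 1 := inv_mul_cancel₀ hpos.ne'
    rw [hf] at h3
    have h4 : e ^ 2 * (β ^ 2 / (2 * w ^ 2) * I) = (β * e) ^ 2 * I / (2 * w ^ 2) := by ring
    rw [h4, div_le_iff₀ (by positivity)] at h3
    linarith
  have hx0 : 0 ≤ β * e := mul_nonneg (by linarith) he
  set x := β * e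
  have hβw : β - 3 / 4 = 1 / 4 - w ^ 2 := by linarith
  rw [hβw]
  rcases le_or_gt w (1 / 4) with hw4 | hw4
  · -- small w
    have hs : π * w * c ≤ Real.sin (π * w) := by
      have := Real.lt_tan (x := π * w) (by positivity) (by nlinarith)
      rw [Real.tan_eq_sin_div_cos, lt_div_iff₀ hcpos] at this
      exact this.le
    have hs2 : Real.sin (π * w) ^ 2 = 1 - c ^ 2 := by
      rw [hc]; linarith [Real.sin_sq_add_cos_sq (π * w)]
    have hch : 1 / 2 ≤ c ^ 2 := by
      have h1 : Real.cos (π / 4) ≤ c :=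
        Real.cos_le_cos_of_nonneg_of_le_pi (by positivity) (by linarith) (by nlinarith)
      rw [Real.cos_pi_div_four] at h1
      have h2 : (Real.sqrt 2 / 2) ^ 2 = 1 / 2 := by
        rw [div_pow, Real.sq_sqrt (by norm_num)]; norm_num
      rw [← h2]
      exact pow_le_pow_left₀ (by positivity) h1 2
    have h1 : 4 * (π * w * c) ^ 2 ≤ I * c ^ 2 := by
      have : (π * w * c) ^ 2 ≤ 1 - c ^ 2 := by
        rw [← hs2]; exact pow_le_pow_left₀ (by positivity) hs 2
      rw [hIc]; nlinarith
    have h2 : 36 * w ^ 2 ≤ I := by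
      have h3 : (4 * (π * w) ^ 2) * c ^ 2 ≤ I * c ^ 2 := by
        refine le_trans (le_of_eq ?_) h1
        ring
      have h4 := le_of_mul_le_mul_right h3 (by positivity)
      have : 9 * w ^ 2 ≤ (π * w) ^ 2 := by
        rw [mul_pow]; apply mul_le_mul_of_nonneg_right _ (sq_nonneg w); nlinarith
      linarith
    have h5 : x ^ 2 ≤ 1 / 18 := by
      have h6 : (18 * x ^ 2) * (2 * w ^ 2) ≤ 1 * (2 * w ^ 2) := by
        have := mul_le_mul_of_nonneg_left h2 (sq_nonneg x)
        linarith
      have := le_of_mul_le_mul_right h6 (by positivity)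
      linarith
    have h7 : x ≤ 0.24 := by nlinarith
    constructor
    · linarith
    · nlinarith
  · have hch : c ^ 2 ≤ 1 / 2 := by
      have h1 : c ≤ Real.cos (π / 4) :=
        Real.cos_le_cos_of_nonneg_of_le_pi (by positivity) (by nlinarith) (by nlinarith)
      rw [Real.cos_pi_div_four] at h1
      have h2 : (Real.sqrt 2 / 2) ^ 2 = 1 / 2 := by
        rw [div_pow, Real.sq_sqrt (by norm_num)]; norm_num
      rw [← h2]
      exact pow_le_pow_left₀ hcpos.le h1 2
    have h1 : 2 ≤ I * c ^ 2 := by rw [hIc]; nlinarith [sq_nonneg A]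
    have h2 : x ^ 2 ≤ (w * c) ^ 2 := by
      have : x ^ 2 * 2 ≤ x ^ 2 * (I * c ^ 2) := mul_le_mul_of_nonneg_left h1 (sq_nonneg _)
      have : x ^ 2 * I * c ^ 2 ≤ 2 * w ^ 2 * c ^ 2 := mul_le_mul_of_nonneg_right hx2 (sq_nonneg _)
      nlinarith
    have h3 : x ≤ w * c := by
      exact (pow_le_pow_iff_left₀ hx0 (by positivity) two_ne_zero).1 h2
    have hcl : c ≤ 3.15 * (1 / 2 - w) := by
      have : c = Real.sin (π / 2 - π * w) := by rw [Real.sin_pi_div_two_sub]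
      rw [this]
      have h5 := mul_le_mul_of_nonneg_right hpi2.le (by linarith : 0 ≤ 1 / 2 - w)
      have h6 := mul_pos Real.pi_pos (by linarith : 0 < 1 / 2 - w)
      refine (Real.sin_le (by linarith)).trans (by linarith)
    exact num_high hw4 hwh hx0 (h3.trans (mul_le_mul_of_nonneg_left hcl hw0.le))

lemma norm_one_of_quad {T : ℝ} (h1 : T ≤ 2) (h2 : -2 ≤ T) (μ : ℂ)
    (h : μ ^ 2 - T * μ + 1 = 0) : ‖μ‖ = 1 := by
  have hre := congrArg Complex.re h
  have him := congrArg Complex.im h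
  simp [pow_two] at hre him
  have hn : ‖μ‖ ^ 2 = μ.re ^ 2 + μ.im ^ 2 := by
    rw [← Complex.normSq_eq_norm_sq, Complex.normSq_apply]; ring
  have hone : μ.re ^ 2 + μ.im ^ 2 = 1 := by
    by_cases hi : μ.im = 0
    · rw [hi] at hre ⊢
      have h3 : (2 * μ.re - T) ^ 2 = T ^ 2 - 4 := by nlinarith
      have h4 : T ^ 2 ≤ 4 := by nlinarith
      have h5 : 2 * μ.re - T = 0 := by
        have : (2 * μ.re - T) ^ 2 = 0 := le_antisymm (by linarith) (sq_nonneg _)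
        exact pow_eq_zero_iff (two_ne_zero) |>.1 this
      nlinarith
    · have h3 : 2 * μ.re = T := by
        have : μ.im * (2 * μ.re - T) = 0 := by linarith
        rcases mul_eq_zero.1 this with h' | h'
        · exact absurd h' hi
        · linarith
      rw [← h3] at hre
      nlinarith
  rw [hone] at hn
  have := norm_nonneg μ
  nlinarith

lemma sol_of_fund {β e : ℝ} {γ : ℝ → Matrix (Fin 2) (Fin 2) ℝ} (hγ : IsFundSol β e γ)
    (j : Fin 2) : Sol (qpot β e) (fun t => γ t 1 j) (fun t => γ t 0 j) := by
  intro t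
  have h0 := hγ.2 t 0 j
  have h1 := hγ.2 t 1 j
  constructor
  · refine h1.congr_deriv ?_
    simp [Jmat, Bmat, Matrix.mul_apply, Fin.sum_univ_two]
  · refine h0.congr_deriv ?_
    simp [Jmat, Bmat, Matrix.mul_apply, Fin.sum_univ_two, qpot]
    ring

/-- Reflection of a solution about `m / 2`. -/
lemma Sol.reflect {q q' y p : ℝ → ℝ} (h : Sol q y p) (m : ℝ) (hq : ∀ t, q (m - t) = q' t) :
    Sol q' (fun t => y (m - t)) (fun t => -(p (m - t))) := by
  intro t
  have hl : HasDerivAt (fun t : ℝ => m - t) (-1) t := (hasDerivAt_id t).const_sub m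
  constructor
  · exact ((h (m - t)).1.comp t hl).congr_deriv (by ring)
  · exact (((h (m - t)).2.comp t hl).neg).congr_deriv (by rw [hq]; ring)

lemma Sol.comb {q y p z r : ℝ → ℝ} (h : Sol q y p) (h' : Sol q z r) (a b : ℝ) :
    Sol q (fun t => a * y t + b * z t) (fun t => a * p t + b * r t) := by
  intro t
  exact ⟨((h t).1.const_mul a).add ((h' t).1.const_mul b),
    (((h t).2.const_mul a).add ((h' t).2.const_mul b)).congr_deriv (by ring)⟩

/-- spectral stability of the monodromy matrix `γ_{β,e}(2π)` :
every complex eigenvalue has modulus 1. -/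
theorem stmt_1 (β e : ℝ) (he1 : e < 1)
    (γ : ℝ → Matrix (Fin 2) (Fin 2) ℝ) (hγ : IsFundSol β e γ)
    (h : (0 ≤ β ∧ β < 3 / 4 ∧ 0 ≤ e ∧ e < 1 / (1 + Real.sqrt (fTrace β))) ∨
         (3 / 4 < β ∧ β < 1 ∧ 0 ≤ e ∧ e < (fTrace β) ^ (-(1 : ℝ) / 2))) :
    ∀ μ : ℂ, Matrix.det ((γ (2 * π)).map (fun x => (x : ℂ)) - μ • 1) = 0 → ‖μ‖ = 1 := by
  have hπ := Real.pi_pos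
  have he0 : 0 ≤ e := by rcases h with h | h <;> exact h.2.2.1
  have hβ0 : 0 ≤ β := by rcases h with h | h <;> linarith [h.1]
  have hβ1 : β ≤ 1 := by rcases h with h | h <;> linarith [h.2.1]
  have hea : |e| < 1 := by rwa [abs_of_nonneg he0]
  have hea' : |-e| < 1 := by rwa [abs_neg]
  have hs := sol_of_fund hγ 0
  have hc := sol_of_fund hγ 1
  have s0 : γ 0 1 0 = 0 := by rw [hγ.1]; simp
  have s0' : γ 0 0 0 = 1 := by rw [hγ.1]; simp
  have c0 : γ 0 1 1 = 1 := by rw [hγ.1]; simp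
  have c0' : γ 0 0 1 = 0 := by rw [hγ.1]; simp
  have hdet : ∀ t, γ t 1 1 * γ t 0 0 - γ t 0 1 * γ t 1 0 = 1 := by
    intro t
    have := wronskian_const hc hs t 0
    simp only [s0, s0', c0, c0'] at this
    linarith
  -- reflection about π
  have hq2 : ∀ t, qpot β e (2 * π - t) = qpot β e t := by
    intro t; unfold qpot; rw [Real.cos_two_pi_sub]
  have hq1 : ∀ t, qpot β e (π - t) = qpot β (-e) t := by
    intro t; unfold qpot; rw [Real.cos_pi_sub]; congr 3; ring
  have hp2 : 2 * π - π = π := by ring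
  have T1 : γ (2 * π) 1 1 = γ π 1 1 * γ π 0 0 + γ π 0 1 * γ π 1 0 := by
    have := wronskian_const (hc.reflect (2 * π) hq2) hs 0 π
    simp only [s0, s0', hp2, sub_zero] at this
    linarith
  have T2 : γ (2 * π) 0 0 = γ π 1 1 * γ π 0 0 + γ π 0 1 * γ π 1 0 := by
    have := wronskian_const hc (hs.reflect (2 * π) hq2) 0 π
    simp only [c0, c0', hp2, sub_zero] at this
    linarith
  have hnd : ∀ t, γ t 1 1 = 0 → γ t 0 1 ≠ 0 := by
    intro t h1 h2
    have := hdet t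
    rw [h1, h2] at this
    norm_num at this
  have hcp : γ π 0 1 ≤ 0 := cprime_nonpos hβ0 hβ1 hea hc c0 c0' hnd
  have hsn : 0 ≤ γ π 1 0 := s_nonneg hs (qpot_le_one hβ0 hea) s0 s0'
  have hdπ := hdet π
  -- the solution normalised at π
  have hz := (hc.comb hs (γ π 0 0) (-(γ π 0 1))).reflect π hq1
  have z0 : γ π 0 0 * γ (π - 0) 1 1 + -(γ π 0 1) * γ (π - 0) 1 0 = 1 := by
    rw [sub_zero]; linarith
  have z0' : -(γ π 0 0 * γ (π - 0) 0 1 + -(γ π 0 1) * γ (π - 0) 0 0) = 0 := by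
    rw [sub_zero]; ring
  have zπ : γ π 0 0 * γ (π - π) 1 1 + -(γ π 0 1) * γ (π - π) 1 0 = γ π 0 0 := by
    rw [sub_self, c0, s0]; ring
  have hndz : ∀ t, γ π 0 0 * γ (π - t) 1 1 + -(γ π 0 1) * γ (π - t) 1 0 = 0 →
      -(γ π 0 0 * γ (π - t) 0 1 + -(γ π 0 1) * γ (π - t) 0 0) ≠ 0 := by
    intro t h1 h2
    have hd := hdet (π - t)
    have e1 : γ π 0 0 = 0 := by
      linear_combination (-(γ π 0 0)) * hd + γ (π - t) 0 0 * h1 + γ (π - t) 1 0 * h2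
    have e2 : γ π 0 1 = 0 := by
      linear_combination (-(γ π 0 1)) * hd + γ (π - t) 0 1 * h1 + γ (π - t) 1 1 * h2
    rw [e1, e2] at hdπ
    norm_num at hdπ
  have hprod : 0 ≤ γ π 1 1 * γ π 0 0 := by
    rcases h with ⟨h1, h2, h3, h4⟩ | ⟨h1, h2, h3, h4⟩
    · have hcond := cond_low h1 h2 h3 he1 h4
      have a1 : γ π 1 1 ≤ 0 :=
        halfint_neg hβ0 hea (by rwa [abs_of_nonneg he0]) hc c0 c0' hnd
      have a2 := halfint_neg hβ0 hea' (by rwa [abs_neg, abs_of_nonneg he0]) hz z0 z0' hndz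
      simp only [zπ] at a2
      nlinarith
    · obtain ⟨k1, k2⟩ := cond_high h1 h2 h3 h4
      have hx0 : 0 ≤ β * e := mul_nonneg hβ0 he0
      have a1 : 0 ≤ γ π 1 1 :=
        halfint_pos h1.le hea (by rwa [abs_of_nonneg hx0]) (by rwa [abs_of_nonneg hx0]) hc c0 c0'
      have a2 := halfint_pos h1.le hea' (by rwa [mul_neg, abs_neg, abs_of_nonneg hx0])
        (by rwa [mul_neg, abs_neg, neg_sq, abs_of_nonneg hx0]) hz z0 z0'
      simp only [zπ] at a2
      exact mul_nonneg a1 a2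
  intro μ hμ
  have hd2 := hdet (2 * π)
  refine norm_one_of_quad (T := γ (2 * π) 0 0 + γ (2 * π) 1 1) ?_ ?_ μ ?_
  · rw [T1, T2]; nlinarith
  · rw [T1, T2]; nlinarith
  · rw [Matrix.det_fin_two] at hμ
    simp at hμ
    have hd2' : (γ (2 * π) 1 1 : ℂ) * γ (2 * π) 0 0 - γ (2 * π) 0 1 * γ (2 * π) 1 0 = 1 := by
      exact_mod_cast hd2
    push_cast
    linear_combination hμ - hd2'
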